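/- Let X be a simple graph as in the context and let α = (M + √(M² + 4M))/2. Then for every complex number u with |u| < 1/α, the series Σ_{m=0}^{∞} C_m u^m converges in operator norm and (Σ_{m=0}^{∞} C_m u^m)(I − uA_X + u²Q_X) = (1 − u²)I. -/

import Mathlib

noncomputable section

/-- The Hilbert space `ℓ²(V)` of square-summable complex functions on `V`. -/
abbrev ℓ2 (V : Type) : Type := lp (fun _ : V => ℂ) 2

namespace SimpleGraph

variable {V : Type} (G : SimpleGraph V)

/-- The degree of a vertex. -/
def gdeg (v : V) : ℕ := Nat.card (G.neighborSet v)

/-- A geodesic (non-backtracking) path of length `m` in a simple graph,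
encoded as its sequence of `m + 1` vertices. -/
def IsGeoPath {m : ℕ} (p : Fin (m + 1) → V) : Prop :=
  (∀ (i : ℕ) (h : i + 1 < m + 1), G.Adj (p ⟨i, by omega⟩) (p ⟨i + 1, h⟩)) ∧
  (∀ (i : ℕ) (h : i + 2 < m + 1), p ⟨i + 2, h⟩ ≠ p ⟨i, by omega⟩)

/-- The number of geodesic loops (closed non-backtracking paths) of length `m`
at `x`. -/
def cLoop (m : ℕ) (x : V) : ℕ :=
  Nat.card {p : Fin (m + 1) → V // G.IsGeoPath p ∧ p 0 = x ∧ p (Fin.last m) = x}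

/-- The formal combinatorial Laplacian applied to `cLoop m`:
`(Δ_X c_m)(x) = deg(x)·c_m(x) − Σ_{y ∼ x} c_m(y)`. -/
def lapc (m : ℕ) (x : V) : ℤ :=
  (G.gdeg x : ℤ) * G.cLoop m x - ∑ᶠ y ∈ G.neighborSet x, (G.cLoop m y : ℤ)

/-- The defining property of the geodesic-path-counting operators `C_m` on
`ℓ²(V)`: `(C_m f)(x) = Σ_c f(t(c))`, the sum over all geodesic paths `c` of
length `m` starting at `x` (so `C₀ = I` and `C₁ = A_X`). -/
def IsGeoCountOp (C : ℕ → (ℓ2 V →L[ℂ] ℓ2 V)) : Prop :=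
  ∀ (m : ℕ) (f : ℓ2 V) (x : V),
    C m f x =
      ∑ᶠ p : {p : Fin (m + 1) → V // G.IsGeoPath p ∧ p 0 = x}, f (p.1 (Fin.last m))

/-- The defining property of the adjacency operator on `ℓ²(V)`:
`(A f)(x) = Σ_{y ∼ x} f(y)`. -/
def IsAdjOp (A : ℓ2 V →L[ℂ] ℓ2 V) : Prop :=
  ∀ (f : ℓ2 V) (x : V), A f x = ∑ᶠ y ∈ G.neighborSet x, f y

/-- The defining property of the valency operator on `ℓ²(V)`:
`(D f)(x) = deg(x)·f(x)`. -/
def IsValOp (D : ℓ2 V →L[ℂ] ℓ2 V) : Prop :=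
  ∀ (f : ℓ2 V) (x : V), D f x = (G.gdeg x : ℂ) * f x

end SimpleGraph

namespace SimpleGraph

variable {V : Type} (G : SimpleGraph V)

/-- The geodesic paths of length `m` starting at `x`. -/
abbrev GeoFrom (m : ℕ) (x : V) : Type :=
  {p : Fin (m + 1) → V // G.IsGeoPath p ∧ p 0 = x}

instance (x : V) : Unique (G.GeoFrom 0 x) where
  default := ⟨fun _ => x, ⟨fun i h => by omega, fun i h => by omega⟩, rfl⟩
  uniq p := Subtype.ext (funext fun i => by rw [Fin.fin_one_eq_zero i]; exact p.2.2)

/-- The vertices by which a geodesic path can be prolonged at its end. -/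
def geoExt {m : ℕ} (p : Fin (m + 1) → V) : Set V :=
  {y | G.Adj (p (Fin.last m)) y ∧ ∀ i : Fin (m + 1), (i : ℕ) + 1 = m → y ≠ p i}

theorem isGeoPath_succ_iff {m : ℕ} (q : Fin (m + 2) → V) :
    G.IsGeoPath q ↔
      G.IsGeoPath (Fin.init q : Fin (m + 1) → V) ∧
        q (Fin.last (m + 1)) ∈ G.geoExt (Fin.init q : Fin (m + 1) → V) := by
  constructor
  · rintro ⟨h1, h2⟩
    refine ⟨⟨fun i h => h1 i (by omega), fun i h => h2 i (by omega)⟩, h1 m (by omega), ?_⟩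
    rintro ⟨i, hi⟩ hm
    simp only at hm
    subst hm
    exact h2 i (by omega)
  · rintro ⟨⟨h1, h2⟩, h3, h4⟩
    refine ⟨fun i h => ?_, fun i h => ?_⟩
    · rcases Nat.lt_or_ge (i + 1) (m + 1) with hi | hi
      · exact h1 i hi
      · obtain rfl : i = m := by omega
        exact h3
    · rcases Nat.lt_or_ge (i + 2) (m + 1) with hi | hi
      · exact h2 i hi
      · obtain rfl : m = i + 1 := by omega
        exact h4 ⟨i, by omega⟩ rfl

/-- A geodesic path of length `m + 1` is a geodesic path of length `m` with a prolongation. -/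
def geoFromSuccEquiv (m : ℕ) (x : V) :
    G.GeoFrom (m + 1) x ≃ Σ p : G.GeoFrom m x, G.geoExt p.1 where
  toFun q := ⟨⟨Fin.init q.1, ((G.isGeoPath_succ_iff q.1).1 q.2.1).1, q.2.2⟩,
    ⟨q.1 (Fin.last (m + 1)), ((G.isGeoPath_succ_iff q.1).1 q.2.1).2⟩⟩
  invFun s := ⟨Fin.snoc (α := fun _ => V) s.1.1 s.2.1, by
    rw [isGeoPath_succ_iff, Fin.init_snoc, Fin.snoc_last]
    exact ⟨⟨s.1.2.1, s.2.2⟩, (Fin.snoc_castSucc (α := fun _ => V) s.2.1 s.1.1 0).trans s.1.2.2⟩⟩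
  left_inv q := Subtype.ext (Fin.snoc_init_self q.1)
  right_inv := by
    rintro ⟨⟨p, hp⟩, ⟨y, hy⟩⟩
    have h : (Fin.init (Fin.snoc (α := fun _ => V) p y) : Fin (m + 1) → V) = p :=
      Fin.init_snoc _ _
    refine Sigma.ext (Subtype.ext h) ?_
    refine (Subtype.heq_iff_coe_eq ?_).2 (Fin.snoc_last (α := fun _ => V) y p)
    intro z
    simp only [h]

variable {G}

theorem finite_geoExt (hfin : ∀ v : V, (G.neighborSet v).Finite) {m : ℕ} (p : Fin (m + 1) → V) :
    (G.geoExt p).Finite :=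
  (hfin _).subset fun _ h => h.1

theorem finite_geoFrom (hfin : ∀ v : V, (G.neighborSet v).Finite) (m : ℕ) (x : V) :
    Finite (G.GeoFrom m x) := by
  induction m with
  | zero => infer_instance
  | succ m ih =>
    have := fun p : G.GeoFrom m x => (finite_geoExt hfin p.1).to_subtype
    exact Finite.of_equiv _ (G.geoFromSuccEquiv m x).symm

theorem finsum_geoFrom_succ (hfin : ∀ v : V, (G.neighborSet v).Finite) (m : ℕ) (x : V)
    (F : V → V → ℂ) :
    ∑ᶠ q : G.GeoFrom (m + 1) x, F (q.1 (Fin.last m).castSucc) (q.1 (Fin.last (m + 1))) =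
      ∑ᶠ p : G.GeoFrom m x, ∑ᶠ y ∈ G.geoExt p.1, F (p.1 (Fin.last m)) y := by
  have := finite_geoFrom hfin m x
  have := fun p : G.GeoFrom m x => (finite_geoExt hfin p.1).to_subtype
  have := Fintype.ofFinite (G.GeoFrom m x)
  have := fun p : G.GeoFrom m x => Fintype.ofFinite (G.geoExt p.1)
  have hequiv := finsum_eq_of_bijective
    (f := fun q : G.GeoFrom (m + 1) x =>
      F (q.1 (Fin.last m).castSucc) (q.1 (Fin.last (m + 1))))
    (g := fun s : Σ p : G.GeoFrom m x, G.geoExt p.1 => F (s.1.1 (Fin.last m)) s.2.1)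
    (G.geoFromSuccEquiv m x) (G.geoFromSuccEquiv m x).bijective fun q => rfl
  rw [hequiv, finsum_eq_sum_of_fintype, finsum_eq_sum_of_fintype, Fintype.sum_sigma]
  refine Finset.sum_congr rfl fun p _ => ?_
  rw [← finsum_set_coe_eq_finsum_mem, finsum_eq_sum_of_fintype]

theorem neighborSet_eq_insert_geoExt {m : ℕ} {q : Fin (m + 2) → V} (hq : G.IsGeoPath q) :
    G.neighborSet (q (Fin.last (m + 1))) = insert (q (Fin.last m).castSucc) (G.geoExt q) := by
  have hadj : G.Adj (q (Fin.last m).castSucc) (q (Fin.last (m + 1))) := hq.1 m (by omega)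
  ext y
  simp only [mem_neighborSet, Set.mem_insert_iff, geoExt, Set.mem_ofPred_eq]
  constructor
  · intro h
    by_cases hy : y = q (Fin.last m).castSucc
    · exact Or.inl hy
    · refine Or.inr ⟨h, fun i hi => ?_⟩
      rwa [show i = (Fin.last m).castSucc from Fin.ext (by simpa using hi)]
  · rintro (rfl | h)
    · exact hadj.symm
    · exact h.1

theorem notMem_geoExt {m : ℕ} (q : Fin (m + 2) → V) :
    q (Fin.last m).castSucc ∉ G.geoExt q :=
  fun h => h.2 (Fin.last m).castSucc (by simp) rfl

theorem geoExt_zero (p : Fin (0 + 1) → V) :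
    G.geoExt p = G.neighborSet (p (Fin.last 0)) := by
  ext y
  simp [geoExt]

theorem ncard_geoExt_zero (p : Fin (0 + 1) → V) :
    (G.geoExt p).ncard = G.gdeg (p (Fin.last 0)) := by
  rw [geoExt_zero, gdeg, Nat.card_coe_set_eq]

theorem ncard_geoExt_succ (hfin : ∀ v : V, (G.neighborSet v).Finite) {m : ℕ}
    {q : Fin (m + 2) → V} (hq : G.IsGeoPath q) :
    (G.geoExt q).ncard + 1 = G.gdeg (q (Fin.last (m + 1))) := by
  rw [gdeg, Nat.card_coe_set_eq, neighborSet_eq_insert_geoExt hq,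
    Set.ncard_insert_of_notMem (notMem_geoExt q) (finite_geoExt hfin q)]

theorem IsGeoCountOp.mul_adj_apply {C : ℕ → (ℓ2 V →L[ℂ] ℓ2 V)} (hC : G.IsGeoCountOp C)
    {A : ℓ2 V →L[ℂ] ℓ2 V} (hA : G.IsAdjOp A)
    (hfin : ∀ v : V, (G.neighborSet v).Finite) (m : ℕ) (f : ℓ2 V) (x : V) :
    C (m + 1) (A f) x = C (m + 2) f x +
      ∑ᶠ p : G.GeoFrom m x, ((G.geoExt p.1).ncard : ℂ) * f (p.1 (Fin.last m)) := by
  have := finite_geoFrom hfin (m + 1) x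
  have hback := finsum_geoFrom_succ hfin m x fun a _ => f a
  have hfwd := finsum_geoFrom_succ hfin (m + 1) x fun _ b => f b
  have hconst : ∀ p : G.GeoFrom m x, ∑ᶠ y ∈ G.geoExt p.1, f (p.1 (Fin.last m)) =
      ((G.geoExt p.1).ncard : ℂ) * f (p.1 (Fin.last m)) := fun p => by
    rw [finsum_mem_eq_finite_toFinset_sum _ (finite_geoExt hfin p.1), Finset.sum_const,
      Set.ncard_eq_toFinset_card _ (finite_geoExt hfin p.1), nsmul_eq_mul]
  simp only [hconst] at hback
  rw [hC, hC, hfwd, ← hback, ← finsum_add_distrib (Set.toFinite _) (Set.toFinite _)]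
  refine finsum_congr fun q => ?_
  rw [hA, neighborSet_eq_insert_geoExt q.2.1,
    finsum_mem_insert _ (notMem_geoExt q.1) (finite_geoExt hfin q.1), add_comm]

theorem IsGeoCountOp.zero {C : ℕ → (ℓ2 V →L[ℂ] ℓ2 V)} (hC : G.IsGeoCountOp C) : C 0 = 1 := by
  ext f x
  rw [hC]
  exact finsum_unique _

theorem IsGeoCountOp.one {C : ℕ → (ℓ2 V →L[ℂ] ℓ2 V)} (hC : G.IsGeoCountOp C)
    {A : ℓ2 V →L[ℂ] ℓ2 V} (hA : G.IsAdjOp A)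
    (hfin : ∀ v : V, (G.neighborSet v).Finite) : C 1 = A := by
  ext f x
  rw [hC, finsum_geoFrom_succ hfin 0 x fun _ b => f b, hA, finsum_unique,
    geoExt_zero]
  rfl

theorem IsGeoCountOp.two {C : ℕ → (ℓ2 V →L[ℂ] ℓ2 V)} (hC : G.IsGeoCountOp C)
    {A D : ℓ2 V →L[ℂ] ℓ2 V} (hA : G.IsAdjOp A) (hD : G.IsValOp D)
    (hfin : ∀ v : V, (G.neighborSet v).Finite) : C 2 = C 1 * A - D := by
  rw [eq_sub_iff_add_eq]
  ext f x
  have h := hC.mul_adj_apply hA hfin 0 f x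
  have hz : D f x = C 0 (D f) x := by rw [hC.zero]; rfl
  change C 2 f x + D f x = C 1 (A f) x
  rw [h, hz, hC 0]
  simp only [ncard_geoExt_zero, hD f]

theorem IsGeoCountOp.add_three {C : ℕ → (ℓ2 V →L[ℂ] ℓ2 V)} (hC : G.IsGeoCountOp C)
    {A D : ℓ2 V →L[ℂ] ℓ2 V} (hA : G.IsAdjOp A) (hD : G.IsValOp D)
    (hfin : ∀ v : V, (G.neighborSet v).Finite) (m : ℕ) :
    C (m + 3) = C (m + 2) * A - C (m + 1) * (D - 1) := by
  rw [eq_sub_iff_add_eq]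
  ext f x
  have h := hC.mul_adj_apply hA hfin (m + 1) f x
  change C (m + 3) f x + C (m + 1) (D f - f) x = C (m + 2) (A f) x
  rw [h, hC (m + 1)]
  congr 1
  refine finsum_congr fun p => ?_
  change D f _ - f _ = _
  rw [hD f, ← ncard_geoExt_succ hfin p.2.1]
  push_cast
  ring

theorem IsAdjOp.norm_le {A : ℓ2 V →L[ℂ] ℓ2 V} (hA : G.IsAdjOp A)
    (hfin : ∀ v : V, (G.neighborSet v).Finite) {M : ℕ} (hM : ∀ v, G.gdeg v ≤ M) :
    ‖A‖ ≤ M := by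
  classical
  refine A.opNorm_le_bound (Nat.cast_nonneg M) fun f => ?_
  have hcard : ∀ v, (hfin v).toFinset.card ≤ M := fun v => by
    rw [← Set.ncard_eq_toFinset_card _ (hfin v), ← Nat.card_coe_set_eq]
    exact hM v
  refine lp.norm_le_of_forall_sum_le (by norm_num) (by positivity) fun s => ?_
  simp only [ENNReal.toReal_ofNat, Real.rpow_two]
  set T := s.biUnion fun x => (hfin x).toFinset
  have hf : ∑ y ∈ T, ‖f y‖ ^ 2 ≤ ‖f‖ ^ 2 := by
    simpa using lp.sum_rpow_le_norm_rpow (p := 2) (by norm_num) f T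
  calc ∑ x ∈ s, ‖A f x‖ ^ 2
      ≤ ∑ x ∈ s, (M : ℝ) * ∑ y ∈ (hfin x).toFinset, ‖f y‖ ^ 2 := by
        refine Finset.sum_le_sum fun x _ => ?_
        rw [hA, finsum_mem_eq_finite_toFinset_sum _ (hfin x)]
        calc ‖∑ y ∈ (hfin x).toFinset, f y‖ ^ 2
            ≤ (∑ y ∈ (hfin x).toFinset, ‖f y‖) ^ 2 := by gcongr; exact norm_sum_le _ _
          _ ≤ (hfin x).toFinset.card * ∑ y ∈ (hfin x).toFinset, ‖f y‖ ^ 2 :=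
            sq_sum_le_card_mul_sum_sq
          _ ≤ _ := by gcongr; exact hcard x
    _ = M * ∑ y ∈ T, ∑ x ∈ s with x ∈ (hfin y).toFinset, ‖f y‖ ^ 2 := by
        rw [← Finset.mul_sum]
        congr 1
        refine Finset.sum_comm' fun x y => ?_
        simp only [T, Finset.mem_biUnion, Finset.mem_filter, Set.Finite.mem_toFinset,
          mem_neighborSet]
        exact ⟨fun h => ⟨⟨h.1, h.2.symm⟩, x, h⟩, fun h => ⟨h.1.1, h.1.2.symm⟩⟩
    _ ≤ M * ∑ y ∈ T, M * ‖f y‖ ^ 2 := by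
        gcongr with y
        rw [Finset.sum_const, nsmul_eq_mul]
        gcongr
        exact (Finset.card_le_card fun x hx => (Finset.mem_filter.1 hx).2).trans (hcard y)
    _ = M ^ 2 * ∑ y ∈ T, ‖f y‖ ^ 2 := by rw [← Finset.mul_sum]; ring
    _ ≤ M ^ 2 * ‖f‖ ^ 2 := by gcongr
    _ = (M * ‖f‖) ^ 2 := by ring

end SimpleGraph

theorem ℓ2.opNorm_le_of_forall_norm_apply_le {V : Type} {T : ℓ2 V →L[ℂ] ℓ2 V} {c : ℝ}
    (hc : 0 ≤ c) (h : ∀ f x, ‖T f x‖ ≤ c * ‖f x‖) : ‖T‖ ≤ c := by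
  refine T.opNorm_le_bound hc fun f => ?_
  have h2 : ‖T f‖ ≤ ‖(c : ℂ) • f‖ := lp.norm_mono (by norm_num) fun x => by
    rw [lp.coeFn_smul, Pi.smul_apply, norm_smul, Complex.norm_real, Real.norm_of_nonneg hc]
    exact h f x
  rwa [norm_smul, Complex.norm_real, Real.norm_of_nonneg hc] at h2

namespace SimpleGraph

variable {V : Type} {G : SimpleGraph V}

theorem IsValOp.norm_le {D : ℓ2 V →L[ℂ] ℓ2 V} (hD : G.IsValOp D) {M : ℕ}
    (hM : ∀ v, G.gdeg v ≤ M) : ‖D‖ ≤ M := by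
  refine ℓ2.opNorm_le_of_forall_norm_apply_le (Nat.cast_nonneg M) fun f x => ?_
  rw [hD, norm_mul, Complex.norm_natCast]
  gcongr
  exact hM x

theorem IsValOp.norm_sub_one_le {D : ℓ2 V →L[ℂ] ℓ2 V} (hD : G.IsValOp D) {M : ℕ}
    (hM : ∀ v, G.gdeg v ≤ M) (hM1 : 1 ≤ M) : ‖D - 1‖ ≤ M := by
  refine ℓ2.opNorm_le_of_forall_norm_apply_le (Nat.cast_nonneg M) fun f x => ?_
  change ‖D f x - f x‖ ≤ _
  rw [hD, ← sub_one_mul, norm_mul]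
  gcongr
  have h1 : (G.gdeg x : ℝ) ≤ M := by exact_mod_cast hM x
  have h2 : (1 : ℝ) ≤ M := by exact_mod_cast hM1
  have h3 : ((G.gdeg x : ℂ) - 1) = ((G.gdeg x - 1 : ℝ) : ℂ) := by push_cast; rfl
  rw [h3, Complex.norm_real, Real.norm_eq_abs, abs_le]
  constructor <;> linarith [(G.gdeg x).cast_nonneg (α := ℝ)]

end SimpleGraph

section NormedRing

variable {R : Type*} [NormedRing R] [NormOneClass R]

/-- The norm growth of a sequence satisfying the recursion of the geodesic counting operators. -/
theorem norm_le_pow_of_geodesic_recursion {C : ℕ → R} {A D : R} {M α : ℝ} (hM : 0 ≤ M)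
    (hMα : M ≤ α) (hα : M * α + M = α ^ 2) (hA : ‖A‖ ≤ M) (hD : ‖D‖ ≤ M) (hQ : ‖D - 1‖ ≤ M)
    (h0 : C 0 = 1) (h1 : C 1 = A) (h2 : C 2 = C 1 * A - D)
    (h3 : ∀ m, C (m + 3) = C (m + 2) * A - C (m + 1) * (D - 1)) (m : ℕ) :
    ‖C m‖ ≤ α ^ m := by
  have hα0 : 0 ≤ α := hM.trans hMα
  have hC1 : ‖C 1‖ ≤ α := by rw [h1]; exact hA.trans hMα
  suffices h : ∀ m, ‖C (m + 1)‖ ≤ α ^ (m + 1) ∧ ‖C (m + 2)‖ ≤ α ^ (m + 2) by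
    cases m with
    | zero => simp [h0]
    | succ m => exact (h m).1
  intro m
  induction m with
  | zero =>
    refine ⟨by simpa using hC1, ?_⟩
    calc ‖C 2‖ ≤ ‖C 1‖ * ‖A‖ + ‖D‖ := by
          rw [h2]; exact (norm_sub_le _ _).trans (by gcongr; exact norm_mul_le _ _)
      _ ≤ α * M + M := by gcongr
      _ = α ^ 2 := by linarith
  | succ m ih =>
    refine ⟨ih.2, ?_⟩
    calc ‖C (m + 3)‖ ≤ ‖C (m + 2)‖ * ‖A‖ + ‖C (m + 1)‖ * ‖D - 1‖ := by
          rw [h3]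
          exact (norm_sub_le _ _).trans <| add_le_add (norm_mul_le _ _) (norm_mul_le _ _)
      _ ≤ α ^ (m + 2) * M + α ^ (m + 1) * M := by
          gcongr
          exacts [ih.2, ih.1]
      _ = α ^ (m + 1) * (M * α + M) := by ring
      _ = α ^ (m + 3) := by rw [hα]; ring

end NormedRing

/-- The generating function of a sequence satisfying the recursion of the geodesic counting
operators. -/
theorem tsum_mul_eq_of_geodesic_recursion {R : Type*} [NormedRing R] [NormedAlgebra ℂ R]
    {C : ℕ → R} {A D : R} {u : ℂ} (hs : Summable fun m => u ^ m • C m)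
    (h0 : C 0 = 1) (h1 : C 1 = A) (h2 : C 2 = C 1 * A - D)
    (h3 : ∀ m, C (m + 3) = C (m + 2) * A - C (m + 1) * (D - 1)) :
    (∑' m, u ^ m • C m) * (1 - u • A + u ^ 2 • (D - 1)) = (1 - u ^ 2) • 1 := by
  set S := ∑' m, u ^ m • C m with hS
  have e1 : S = 1 + ∑' m, u ^ (m + 1) • C (m + 1) := by
    rw [hS, hs.tsum_eq_zero_add]; simp [h0]
  have hs1 := (summable_nat_add_iff 1).2 hs
  have hs2 := (summable_nat_add_iff 2).2 hs
  have e2 : ∑' m, u ^ (m + 1) • C (m + 1) = u • A + ∑' m, u ^ (m + 2) • C (m + 2) := by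
    rw [hs1.tsum_eq_zero_add]; simp [h1]
  have e3 : ∑' m, u ^ (m + 2) • C (m + 2) =
      u ^ 2 • (A * A - D) + ∑' m, u ^ (m + 3) • C (m + 3) := by
    rw [hs2.tsum_eq_zero_add]; simp [h2, h1]
  have e4 : ∑' m, u ^ (m + 3) • C (m + 3) =
      (∑' m, u ^ (m + 2) • C (m + 2)) * (u • A) -
        (∑' m, u ^ (m + 1) • C (m + 1)) * (u ^ 2 • (D - 1)) := by
    rw [← hs2.tsum_mul_right, ← hs1.tsum_mul_right,
      ← (hs2.mul_right _).tsum_sub (hs1.mul_right _)]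
    refine tsum_congr fun m => ?_
    rw [h3, smul_sub, smul_mul_smul_comm, smul_mul_smul_comm]
    congr 2
    all_goals ring
  set T1 := ∑' m, u ^ (m + 1) • C (m + 1)
  set T2 := ∑' m, u ^ (m + 2) • C (m + 2)
  have hexp : S = 1 + (u • A + (u ^ 2 • (A * A - D) +
      (T2 * (u • A) - T1 * (u ^ 2 • (D - 1))))) := by
    rw [e1, ← e4, ← e3, ← e2]
  have key : S * (1 - u • A + u ^ 2 • (D - 1)) =
      S - (1 + (u • A + T2)) * (u • A) + (1 + T1) * (u ^ 2 • (D - 1)) := by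
    rw [← e2, ← e1]; noncomm_ring
  rw [key, hexp]
  simp only [add_mul, one_mul, smul_mul_smul_comm, smul_sub, sub_smul, one_smul, ← pow_two u]
  abel

/-- For `|u| < 1/α` with `α = (M + √(M² + 4M))/2`, `M = sup_x deg(x)`:
the series `Σ_m C_m u^m` converges in operator norm and
`(Σ_m C_m u^m)(I − uA_X + u²Q_X) = (1 − u²)I`. -/
theorem C_series_inverse {V : Type} (G : SimpleGraph V) [Countable V]
    (hconn : G.Connected)
    (hfin : ∀ v : V, (G.neighborSet v).Finite)
    (hbd : ∃ M₀ : ℕ, ∀ v : V, G.gdeg v ≤ M₀)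
    (hdeg1 : ∀ v : V, G.gdeg v ≠ 1)
    (M : ℕ) (hM : M = sSup (Set.range fun v : V => G.gdeg v))
    (A D : ℓ2 V →L[ℂ] ℓ2 V) (hA : G.IsAdjOp A) (hD : G.IsValOp D)
    (C : ℕ → (ℓ2 V →L[ℂ] ℓ2 V)) (hC : G.IsGeoCountOp C)
    (u : ℂ) (hu : ‖u‖ < 1 / (((M : ℝ) + Real.sqrt ((M : ℝ) ^ 2 + 4 * M)) / 2)) :
    Summable (fun m : ℕ => u ^ m • C m) ∧
      (∑' m : ℕ, u ^ m • C m) * (1 - u • A + u ^ 2 • (D - 1)) = (1 - u ^ 2) • 1 := by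
  have hdeg : ∀ v, G.gdeg v ≤ M := fun v => by
    obtain ⟨M₀, hM₀⟩ := hbd
    rw [hM]
    exact le_csSup ⟨M₀, by rintro _ ⟨w, rfl⟩; exact hM₀ w⟩ ⟨v, rfl⟩
  set α : ℝ := ((M : ℝ) + Real.sqrt ((M : ℝ) ^ 2 + 4 * M)) / 2 with hα
  have hαpos : 0 < α := one_div_pos.1 ((norm_nonneg u).trans_lt hu)
  have hM1 : 1 ≤ M := by
    rcases Nat.eq_zero_or_pos M with h | h
    · simp [hα, h] at hαpos
    · exact h
  have hsq : Real.sqrt ((M : ℝ) ^ 2 + 4 * M) ^ 2 = (M : ℝ) ^ 2 + 4 * M :=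
    Real.sq_sqrt (by positivity)
  have hMα : (M : ℝ) ≤ α := by
    have : (M : ℝ) ≤ Real.sqrt ((M : ℝ) ^ 2 + 4 * M) :=
      Real.le_sqrt_of_sq_le (le_add_of_nonneg_right (by positivity))
    linarith
  have hαeq : (M : ℝ) * α + M = α ^ 2 := by
    rw [hα]
    linear_combination -hsq / 4
  have h0 := hC.zero
  have h1 := hC.one hA hfin
  have h2 := hC.two hA hD hfin
  have h3 := hC.add_three hA hD hfin
  have : Nontrivial (ℓ2 V) := by
    classical
    obtain ⟨v⟩ := hconn.nonempty
    refine ⟨lp.single 2 v (1 : ℂ), 0, fun h => ?_⟩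
    have := congrArg (fun f : ℓ2 V => f v) h
    simp at this
  have hnorm := norm_le_pow_of_geodesic_recursion (Nat.cast_nonneg M) hMα hαeq
    (hA.norm_le hfin hdeg) (hD.norm_le hdeg) (hD.norm_sub_one_le hdeg hM1) h0 h1 h2 h3
  have hs : Summable fun m : ℕ => u ^ m • C m := by
    refine Summable.of_norm_bounded (g := fun m => (‖u‖ * α) ^ m)
      (summable_geometric_of_lt_one (by positivity) ((lt_div_iff₀ hαpos).1 hu)) fun m => ?_
    rw [norm_smul, norm_pow, mul_pow]
    gcongr
    exact hnorm m
  exact ⟨hs, tsum_mul_eq_of_geodesic_recursion hs h0 h1 h2 h3⟩
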